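/- arXiv:math/9909048 — 2 statements merged into one kernel-verified Lean document; each statement's English description precedes it below -/
import Mathlib

section
/- Let H be a separable complex Hilbert space of dimension at least 3 and let φ : B(H) → B(H) be a continuous multiplicative map preserving the rank of finite-rank operators (rank φ(A) = rank A for all A ∈ F(H)). Then there exist maps T, S : H → H, either both bounded linear or both bounded conjugate-linear, with ST = I, such that φ(A) = T A S for all A ∈ B(H). -/
/-- A family with separating continuous maps in the style of a biorthogonal system is
countable. -/
lemma countable_of_biorthogonal {ι X Y : Type*} [TopologicalSpace X] [SecondCountableTopology X]
    [TopologicalSpace Y] [T1Space Y] [Zero Y] (x : ι → X) (L : ι → X → Y)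
    (hL : ∀ i, Continuous (L i)) (hdiag : ∀ i, L i (x i) ≠ 0)
    (hoff : ∀ i j, i ≠ j → L i (x j) = 0) : Countable ι := by
  let : TopologicalSpace ι := TopologicalSpace.induced x inferInstance
  have : SecondCountableTopology ι := TopologicalSpace.secondCountableTopology_induced ι X x
  have : DiscreteTopology ι := by
    refine discreteTopology_iff_isOpen_singleton.mpr fun i => ?_
    have : ({i} : Set ι) = x ⁻¹' (L i ⁻¹' {0}ᶜ) := by
      ext j
      by_cases h : i = j
      · subst h; simp [hdiag]
      · simp [hoff i j h, Ne.symm h]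
    rw [this]
    exact (isOpen_compl_singleton.preimage (hL i)).preimage continuous_induced_dom
  exact TopologicalSpace.separableSpace_iff_countable.mp inferInstance

/-- Every orthonormal family indexed like a Hilbert basis is the image of that basis under a linear
isometry. -/
lemma HilbertBasis.exists_linearIsometry {ι H : Type*} [NormedAddCommGroup H]
    [InnerProductSpace ℂ H] [CompleteSpace H] (b : HilbertBasis ι ℂ H) {v : ι → H}
    (hv : Orthonormal ℂ v) : ∃ W : H →ₗᵢ[ℂ] H, ∀ i, W (b i) = v i := by
  classical
  refine ⟨hv.orthogonalFamily.linearIsometry.comp b.repr.toLinearIsometry, fun i => ?_⟩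
  change hv.orthogonalFamily.linearIsometry (b.repr (b i)) = v i
  rw [b.repr_self]
  exact (hv.orthogonalFamily.linearIsometry_apply_single _).trans (by simp)

/-- A separable infinite-dimensional Hilbert space carries uncountably many isometries whose ranges
are pairwise orthogonal up to finite rank. -/
lemma exists_almost_orthogonal_isometries {H : Type*} [NormedAddCommGroup H]
    [InnerProductSpace ℂ H] [CompleteSpace H] [TopologicalSpace.SeparableSpace H]
    (hinf : ¬ FiniteDimensional ℂ H) :
    ∃ W : (ℕ → Bool) → H →L[ℂ] H, (∀ f, (W f).adjoint * W f = 1) ∧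
      ∀ f g, f ≠ g → FiniteDimensional ℂ
        (LinearMap.range (((W g).adjoint * W f : H →L[ℂ] H) : H →ₗ[ℂ] H)) := by
  classical
  have : SecondCountableTopology H := UniformSpace.secondCountable_of_separable H
  obtain ⟨s, b, -⟩ := exists_hilbertBasis ℂ H
  have : Countable s := countable_of_biorthogonal b (fun i x => inner ℂ (b i) x)
    (fun i => by fun_prop) (fun i => by simp [b.orthonormal.1 i])
    (fun i j h => b.orthonormal.2 h)
  have : Infinite s := by
    by_contra h
    rw [not_infinite_iff_finite] at h
    have := Fintype.ofFinite s
    exact hinf b.toOrthonormalBasis.toBasis.finiteDimensional_of_finite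
  obtain ⟨d⟩ := nonempty_equiv_of_countable (α := s) (β := ℕ)
  obtain ⟨c⟩ := nonempty_equiv_of_countable (α := List Bool) (β := s)
  let code : (ℕ → Bool) → s → s := fun f i => c (List.ofFn fun k : Fin (d i) => f k)
  have hcode : ∀ f g i j, code f i = code g j → i = j ∧ ∀ k < d i, f k = g k := by
    intro f g i j h
    have h1 := c.injective h
    have hlen : d i = d j := by simpa using congrArg List.length h1
    obtain rfl := d.injective hlen
    exact ⟨rfl, fun k hk => congrFun (List.ofFn_injective h1) ⟨k, hk⟩⟩
  have hW : ∀ f, ∃ W : H →ₗᵢ[ℂ] H, ∀ i, W (b i) = b (code f i) := fun f =>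
    b.exists_linearIsometry
      (b.orthonormal.comp (code f) fun i j h => (hcode f f i j h).1)
  choose W hW using hW
  refine ⟨fun f => (W f).toContinuousLinearMap, fun f => ?_, fun f g hfg => ?_⟩
  · ext x
    refine ext_inner_left ℂ fun y => ?_
    simp [ContinuousLinearMap.adjoint_inner_right]
  · obtain ⟨n, hn⟩ := Function.ne_iff.mp hfg
    set A : H →L[ℂ] H :=
      (W g).toContinuousLinearMap.adjoint * (W f).toContinuousLinearMap with hA
    let t : Set s := {i | d i ≤ n}
    have ht : t.Finite := (Set.finite_Iic n).preimage d.injective.injOn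
    have hzero : ∀ i ∉ t, A (b i) = 0 := by
      intro i hi
      have : Dense (Submodule.span ℂ (Set.range b) : Set H) :=
        Submodule.dense_iff_topologicalClosure_eq_top.mpr b.dense_span
      have hz : innerSL ℂ (A (b i)) = 0 := by
        refine ContinuousLinearMap.ext_on this ?_
        rintro _ ⟨j, rfl⟩
        have : code f i ≠ code g j := fun h => hn ((hcode f g i j h).2 n (by simpa [t] using hi))
        simp [hA, ContinuousLinearMap.adjoint_inner_left, hW, b.orthonormal.2 this]
      simpa using congrArg (fun l => l (A (b i))) hz
    let V : Submodule ℂ H := Submodule.span ℂ (b '' t)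
    have : FiniteDimensional ℂ V := FiniteDimensional.span_of_finite ℂ (ht.image b)
    have hfac : A = A * V.starProjection := by
      refine ContinuousLinearMap.ext_on
        (Submodule.dense_iff_topologicalClosure_eq_top.mpr b.dense_span) ?_
      rintro _ ⟨i, rfl⟩
      by_cases hi : i ∈ t
      · have : b i ∈ V := Submodule.subset_span ⟨i, hi, rfl⟩
        simp [Submodule.starProjection_eq_self_iff.mpr this]
      · have : b i ∈ Vᗮ := by
          rw [Submodule.mem_orthogonal]
          intro u hu
          induction hu using Submodule.span_induction with
          | mem x hx =>
            obtain ⟨j, hj, rfl⟩ := hx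
            exact b.orthonormal.2 fun h => hi (h ▸ hj)
          | zero => simp
          | add x y _ _ hx hy => simp [inner_add_left, hx, hy]
          | smul a x _ hx => simp [inner_smul_left, hx]
        simp [hzero i hi, (Submodule.starProjection_apply_eq_zero_iff V).mpr this]
    have hle : LinearMap.range (A : H →ₗ[ℂ] H) ≤ V.map (A : H →ₗ[ℂ] H) := by
      rintro _ ⟨x, rfl⟩
      refine ⟨V.starProjection x, Submodule.starProjection_apply_mem V x, ?_⟩
      exact (congrArg (fun B : H →L[ℂ] H => B x) hfac).symm
    exact Submodule.finiteDimensional_of_le hle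

/-- A multiplicative map on the bounded operators of a separable Hilbert space which annihilates the
finite-rank operators is zero. -/
lemma eq_zero_of_mul_of_finite_rank_eq_zero {H : Type*} [NormedAddCommGroup H]
    [InnerProductSpace ℂ H] [CompleteSpace H] [TopologicalSpace.SeparableSpace H]
    (ψ : (H →L[ℂ] H) → (H →L[ℂ] H)) (hmul : ∀ A B, ψ (A * B) = ψ A * ψ B)
    (hfin : ∀ A : H →L[ℂ] H, FiniteDimensional ℂ (LinearMap.range (A : H →ₗ[ℂ] H)) → ψ A = 0)
    (A : H →L[ℂ] H) : ψ A = 0 := by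
  suffices h : ψ 1 = 0 by rw [← mul_one A, hmul, h, mul_zero]
  by_cases hH : FiniteDimensional ℂ H
  · exact hfin 1 inferInstance
  by_contra hne
  obtain ⟨W, hW1, hW2⟩ := exists_almost_orthogonal_isometries hH
  have : SecondCountableTopology H := UniformSpace.secondCountable_of_separable H
  obtain ⟨y, hy⟩ : ∃ y, ψ 1 y ≠ 0 := by
    by_contra! h
    exact hne (ContinuousLinearMap.ext h)
  have key : ∀ f g, ψ (W f).adjoint (ψ (W g) y) = ψ ((W f).adjoint * W g) y := fun f g => by
    rw [hmul]; rfl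
  have : Countable (ℕ → Bool) :=
    countable_of_biorthogonal (fun f => ψ (W f) y) (fun f => ψ (W f).adjoint)
      (fun f => (ψ (W f).adjoint).continuous)
      (fun f => by rw [key, hW1]; exact hy)
      (fun f g h => by rw [key, hfin _ (hW2 g f h.symm)]; rfl)
  have hle := Cardinal.mk_le_aleph0_iff.mpr this
  simp only [Cardinal.mk_pi, Cardinal.mk_bool, Cardinal.prod_const, Cardinal.lift_id,
    Cardinal.mk_nat] at hle
  exact (Cardinal.cantor _).not_ge hle

open InnerProductSpace in
/-- The action of a multiplicative map `φ` on rank-one operators, expressed by a map `τ` on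
vectors, a map `τ'` on the vectors representing functionals, and a map `h` on scalars. -/
structure IsRankOneModel {H : Type*} [NormedAddCommGroup H] [InnerProductSpace ℂ H]
    [CompleteSpace H] (φ : (H →L[ℂ] H) → (H →L[ℂ] H)) (h : ℂ → ℂ) (τ τ' : H → H) : Prop where
  continuous_scalar : Continuous h
  continuous_left : Continuous τ
  continuous_right : Continuous τ'
  scalar_one : h 1 = 1
  scalar_zero : h 0 = 0
  scalar_mul : ∀ a b, h (a * b) = h a * h b
  apply_rankOne : ∀ x v y, φ (rankOne ℂ x v) y = inner ℂ (τ' v) y • τ x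
  apply_left : ∀ A x, φ A (τ x) = τ (A x)
  inner_apply : ∀ A v y, inner ℂ (τ' v) (φ A y) = inner ℂ (τ' (A.adjoint v)) y
  inner_left : ∀ v x, inner ℂ (τ' v) (τ x) = h (inner ℂ v x)
  left_smul : ∀ (a : ℂ) x, τ (a • x) = h a • τ x
  inner_smul : ∀ (a : ℂ) v y, inner ℂ (τ' (a • v)) y = h (starRingEnd ℂ a) * inner ℂ (τ' v) y

open InnerProductSpace in
/-- A continuous multiplicative map preserving finite ranks has a model on rank-one operators. -/
lemma exists_isRankOneModel {H : Type*} [NormedAddCommGroup H] [InnerProductSpace ℂ H]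
    [CompleteSpace H] [Nontrivial H] {φ : (H →L[ℂ] H) → (H →L[ℂ] H)} (hcont : Continuous φ)
    (hmul : ∀ A B, φ (A * B) = φ A * φ B) (hzero : φ 0 = 0)
    (hone : ∀ x v : H, x ≠ 0 → v ≠ 0 →
      Module.finrank ℂ (LinearMap.range (φ (rankOne ℂ x v) : H →ₗ[ℂ] H)) = 1) :
    ∃ h τ τ', IsRankOneModel φ h τ τ' := by
  obtain ⟨e, he⟩ := exists_norm_eq H zero_le_one
  have he0 : e ≠ 0 := by rintro rfl; simp at he
  have hee : inner ℂ e e = (1 : ℂ) := by simp [inner_self_eq_norm_sq_to_K, he]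
  have hP := hone e e he0 he0
  set P := rankOne ℂ e e with hPdef
  have hmul' : ∀ A B y, φ A (φ B y) = φ (A * B) y := fun A B y => by rw [hmul]; rfl
  have hPP : P * P = P := isIdempotentElem_rankOne_self he
  obtain ⟨u, hu1, huP⟩ : ∃ u : H, ‖u‖ = 1 ∧ ∀ y, ∃ c : ℂ, φ P y = c • u := by
    obtain ⟨w, hw0, hw⟩ := finrank_eq_one_iff'.mp hP
    have hw0' : (w : H) ≠ 0 := by simpa using hw0
    refine ⟨((‖(w : H)‖⁻¹ : ℝ) : ℂ) • (w : H), ?_, fun y => ?_⟩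
    · rw [norm_smul]; simp [hw0']
    · obtain ⟨c, hc⟩ := hw ⟨φ P y, y, rfl⟩
      refine ⟨c * ‖(w : H)‖, ?_⟩
      rw [smul_smul, mul_assoc]
      have : (‖(w : H)‖ : ℂ) ≠ 0 := by simpa using hw0'
      simp only [Complex.ofReal_inv, mul_inv_cancel₀ this, mul_one]
      exact (congrArg Subtype.val hc).symm
  have huu : inner ℂ u u = (1 : ℂ) := by simp [inner_self_eq_norm_sq_to_K, hu1]
  have hu0 : u ≠ 0 := by rintro rfl; simp at hu1
  set u' := (φ P).adjoint u with hu'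
  have hPy : ∀ y, φ P y = inner ℂ u' y • u := by
    intro y
    obtain ⟨c, hc⟩ := huP y
    rw [hu', ContinuousLinearMap.adjoint_inner_left, hc, inner_smul_right, huu, mul_one]
  have hPne : ∃ y, φ P y ≠ 0 := by
    by_contra! h
    have h0 : (φ P : H →ₗ[ℂ] H) = 0 := LinearMap.ext h
    rw [h0, LinearMap.range_zero, finrank_bot] at hP
    exact zero_ne_one hP
  have hu'u : inner ℂ u' u = (1 : ℂ) := by
    obtain ⟨y, hy⟩ := hPne
    have h1 := hmul' P P y
    rw [hPP, hPy y, map_smul, hPy u, smul_smul] at h1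
    have hc : inner ℂ u' y ≠ 0 := by
      intro h; rw [hPy, h, zero_smul] at hy; exact hy rfl
    have h2 := smul_left_injective ℂ hu0 h1
    exact mul_left_cancel₀ hc (by simpa using h2)
  have hPu : φ P u = u := by rw [hPy, hu'u, one_smul]
  let h : ℂ → ℂ := fun a => inner ℂ u' (φ (a • P) u)
  have hsm : ∀ (a : ℂ) y, φ (a • P) y = (inner ℂ u' y * h a) • u := by
    intro a y
    have h1 : P * (a • P) * P = a • P := by simp [hPP]
    rw [← h1, ← hmul', ← hmul', hPy y, hPy]
    simp [h]
  refine ⟨h, fun x => φ (rankOne ℂ x e) u, fun v => (φ (rankOne ℂ e v)).adjoint u', ?_⟩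
  constructor
  · fun_prop
  · fun_prop
  · have : Continuous fun A : H →L[ℂ] H => A.adjoint := LinearIsometryEquiv.continuous _
    fun_prop
  · simp [h, hPu, hu'u]
  · simp [h, hzero]
  · intro a b
    have : (a * b) • P = (a • P) * (b • P) := by simp [hPP, smul_smul, mul_comm]
    have hab : φ ((a * b) • P) u = h b • φ (a • P) u := by
      rw [this, ← hmul', hsm b, hu'u, one_mul, map_smul]
    change inner ℂ u' (φ ((a * b) • P) u) = _
    rw [hab, inner_smul_right]
    exact mul_comm _ _
  · intro x v y
    have : rankOne ℂ x v = rankOne ℂ x e * (P * rankOne ℂ e v) := by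
      ext z; simp [hPdef, he]
    rw [this, ← hmul', ← hmul', hPy, map_smul, ContinuousLinearMap.adjoint_inner_left _ y u']
  · intro A x
    rw [hmul']
    rw [show A * rankOne ℂ x e = rankOne ℂ (A x) e from comp_rankOne x e A]
  · intro A v y
    simp only [ContinuousLinearMap.adjoint_inner_left]
    rw [hmul']
    congr 3
    ext z; simp [ContinuousLinearMap.adjoint_inner_left]
  · intro v x
    simp only [ContinuousLinearMap.adjoint_inner_left, h]
    rw [hmul']
    congr 3
    ext z; simp [hPdef, smul_smul, mul_comm]
  · intro a x
    have : rankOne ℂ (a • x) e = rankOne ℂ x e * (a • P) := by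
      ext z; simp [hPdef, he, smul_smul]
    rw [this, ← hmul', hsm, hu'u, one_mul, map_smul]
  · intro a v y
    have : rankOne ℂ e (a • v) = (starRingEnd ℂ a • P) * rankOne ℂ e v := by
      ext z; simp [hPdef, he, smul_smul]
    simp only [ContinuousLinearMap.adjoint_inner_left]
    rw [this, ← hmul', hsm, inner_smul_right, hu'u, mul_one, mul_comm]

namespace IsRankOneModel

variable {H : Type*} [NormedAddCommGroup H] [InnerProductSpace ℂ H] [CompleteSpace H]
  {φ : (H →L[ℂ] H) → (H →L[ℂ] H)} {h : ℂ → ℂ} {τ τ' : H → H}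

/-- The image of the projection onto a finite-dimensional subspace, in terms of an orthonormal
basis of that subspace. -/
lemma apply_starProjection (m : IsRankOneModel φ h τ τ') (W : Submodule ℂ H)
    [FiniteDimensional ℂ W]
    (hr : FiniteDimensional ℂ (LinearMap.range (φ W.starProjection : H →ₗ[ℂ] H)) ∧
      Module.finrank ℂ (LinearMap.range (φ W.starProjection : H →ₗ[ℂ] H)) = Module.finrank ℂ W)
    {ι : Type*} [Fintype ι] (b : OrthonormalBasis ι ℂ W) (z : H) :
    φ W.starProjection z = ∑ i, inner ℂ (τ' (b i)) z • τ (b i) := by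
  classical
  obtain ⟨_, hr⟩ := hr
  have hQ : ∀ w : W, W.starProjection w = w := fun w =>
    Submodule.starProjection_eq_self_iff.mpr w.2
  have hortho : ∀ i j, inner ℂ (τ' (b i)) (τ (b j)) = if i = j then (1 : ℂ) else 0 := by
    intro i j
    rw [m.inner_left, ← Submodule.coe_inner, orthonormal_iff_ite.mp b.orthonormal]
    split_ifs <;> simp [m.scalar_one, m.scalar_zero]
  have hcoef : ∀ (c : ι → ℂ) j, inner ℂ (τ' (b j)) (∑ i, c i • τ (b i)) = c j := by
    intro c j
    simp [hortho]
  have hli : LinearIndependent ℂ fun i => τ (b i) := by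
    rw [Fintype.linearIndependent_iff]
    intro c hc j
    rw [← hcoef c j, hc, inner_zero_right]
  have hspan : Submodule.span ℂ (Set.range fun i => τ (b i)) =
      LinearMap.range (φ W.starProjection : H →ₗ[ℂ] H) := by
    refine Submodule.eq_of_le_of_finrank_eq ?_ ?_
    · rw [Submodule.span_le]
      rintro _ ⟨i, rfl⟩
      exact ⟨τ (b i), by simp [m.apply_left, hQ]⟩
    · rw [finrank_span_eq_card hli, hr, Module.finrank_eq_card_basis b.toBasis]
  have hz : φ W.starProjection z ∈ Submodule.span ℂ (Set.range fun i => τ (b i)) := by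
    rw [hspan]; exact ⟨z, rfl⟩
  obtain ⟨c, hc⟩ := (Submodule.mem_span_range_iff_exists_fun ℂ).mp hz
  rw [← hc]
  refine Finset.sum_congr rfl fun j _ => ?_
  congr 1
  rw [← hcoef c j, hc, m.inner_apply, W.starProjection_isSymmetric.isSelfAdjoint.adjoint_eq, hQ]

/-- The map on vectors in coordinates of an orthonormal basis of a finite-dimensional subspace. -/
lemma left_eq_sum (m : IsRankOneModel φ h τ τ') (W : Submodule ℂ H) [FiniteDimensional ℂ W]
    (hr : FiniteDimensional ℂ (LinearMap.range (φ W.starProjection : H →ₗ[ℂ] H)) ∧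
      Module.finrank ℂ (LinearMap.range (φ W.starProjection : H →ₗ[ℂ] H)) = Module.finrank ℂ W)
    {ι : Type*} [Fintype ι] (b : OrthonormalBasis ι ℂ W) {x : H} (hx : x ∈ W) :
    τ x = ∑ i, h (inner ℂ (b i : H) x) • τ (b i) := by
  have h1 := m.apply_starProjection W hr b (τ x)
  rw [m.apply_left, Submodule.starProjection_eq_self_iff.mpr hx] at h1
  simpa only [m.inner_left] using h1

lemma scalar_add (m : IsRankOneModel φ h τ τ') (W : Submodule ℂ H) [FiniteDimensional ℂ W]
    (hr : FiniteDimensional ℂ (LinearMap.range (φ W.starProjection : H →ₗ[ℂ] H)) ∧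
      Module.finrank ℂ (LinearMap.range (φ W.starProjection : H →ₗ[ℂ] H)) = Module.finrank ℂ W)
    (hW : Module.finrank ℂ W = 2) (a c : ℂ) : h (a + c) = h a + h c := by
  let b : OrthonormalBasis (Fin 2) ℂ W := (stdOrthonormalBasis ℂ W).reindex (finCongr hW)
  have hb : ∀ i j, inner ℂ (b i : H) (b j) = if i = j then (1 : ℂ) else 0 := fun i j => by
    rw [← Submodule.coe_inner, orthonormal_iff_ite.mp b.orthonormal]
  have hτ : τ (b 0 + b 1 : H) = τ (b 0) + τ (b 1) := by
    rw [m.left_eq_sum W hr b (W.add_mem (b 0).2 (b 1).2)]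
    simp [-inner_self_eq_norm_sq_to_K, Fin.sum_univ_two, hb, m.scalar_one]
  have hin := congrArg
    (inner ℂ (τ' (starRingEnd ℂ a • (b 0 : H) + starRingEnd ℂ c • (b 1 : H)))) hτ
  rw [inner_add_right, m.inner_left, m.inner_left, m.inner_left] at hin
  simpa [-inner_self_eq_norm_sq_to_K, inner_add_left, inner_add_right, inner_smul_left, hb]
    using hin

lemma left_add (m : IsRankOneModel φ h τ τ') (hadd : ∀ a c, h (a + c) = h a + h c)
    (hr : ∀ (W : Submodule ℂ H) [FiniteDimensional ℂ W],
      FiniteDimensional ℂ (LinearMap.range (φ W.starProjection : H →ₗ[ℂ] H)) ∧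
      Module.finrank ℂ (LinearMap.range (φ W.starProjection : H →ₗ[ℂ] H)) = Module.finrank ℂ W)
    (x y : H) : τ (x + y) = τ x + τ y := by
  let W : Submodule ℂ H := Submodule.span ℂ {x, y}
  have : FiniteDimensional ℂ W := FiniteDimensional.span_of_finite ℂ (by simp)
  have hx : x ∈ W := Submodule.subset_span (by simp)
  have hy : y ∈ W := Submodule.subset_span (by simp)
  have key := fun z => m.left_eq_sum W (hr W) (stdOrthonormalBasis ℂ W) (x := z)
  rw [key _ hx, key _ hy, key _ (W.add_mem hx hy), ← Finset.sum_add_distrib]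
  simp only [inner_add_right, hadd, add_smul]

lemma right_add (m : IsRankOneModel φ h τ τ') (hadd : ∀ a c, h (a + c) = h a + h c)
    (hr : ∀ (W : Submodule ℂ H) [FiniteDimensional ℂ W],
      FiniteDimensional ℂ (LinearMap.range (φ W.starProjection : H →ₗ[ℂ] H)) ∧
      Module.finrank ℂ (LinearMap.range (φ W.starProjection : H →ₗ[ℂ] H)) = Module.finrank ℂ W)
    (v w : H) : τ' (v + w) = τ' v + τ' w := by
  let W : Submodule ℂ H := Submodule.span ℂ {v, w}
  have : FiniteDimensional ℂ W := FiniteDimensional.span_of_finite ℂ (by simp)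
  have hv : v ∈ W := Submodule.subset_span (by simp)
  have hw : w ∈ W := Submodule.subset_span (by simp)
  refine ext_inner_right ℂ fun y => ?_
  have key : ∀ z ∈ W, inner ℂ (τ' z) y = inner ℂ (τ' z) (φ W.starProjection y) := by
    intro z hz
    rw [m.inner_apply, W.starProjection_isSymmetric.isSelfAdjoint.adjoint_eq,
      Submodule.starProjection_eq_self_iff.mpr hz]
  rw [inner_add_left, key _ hv, key _ hw, key _ (W.add_mem hv hw),
    m.apply_starProjection W (hr W) (stdOrthonormalBasis ℂ W)]
  simp only [inner_sum, inner_smul_right, m.inner_left, inner_add_left, hadd, mul_add,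
    Finset.sum_add_distrib]

/-- When the scalar map is an isometric involution, the map on functionals
has an adjoint on vectors. -/
lemma exists_right_adjoint {σ : ℂ →+* ℂ} [RingHomInvPair σ σ] (m : IsRankOneModel φ σ τ τ')
    (hnorm : ∀ a, ‖σ a‖ = ‖a‖)
    (hadd : ∀ v w, τ' (v + w) = τ' v + τ' w) :
    ∃ S : H →SL[σ] H, ∀ v y, inner ℂ v (S y) = σ (inner ℂ (τ' v) y) := by
  have hσσ : ∀ a, σ (σ a) = a := fun _ => RingHomInvPair.comp_apply_eq (σ := σ) (σ' := σ)
  let R : H →L[ℝ] H := (AddMonoidHom.mk' τ' hadd).toRealLinearMap m.continuous_right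
  have hR : ∀ v, ‖τ' v‖ ≤ ‖R‖ * ‖v‖ := fun v => R.le_opNorm v
  have hex : ∀ y, ∃ z, ∀ v, inner ℂ v z = σ (inner ℂ (τ' v) y) := by
    intro y
    let l : H →ₗ[ℂ] ℂ :=
      { toFun := fun v => starRingEnd ℂ (σ (inner ℂ (τ' v) y))
        map_add' := fun v w => by simp only [hadd, inner_add_left, map_add]
        map_smul' := fun a v => by
          simp only [m.inner_smul, map_mul, hσσ, RingHom.id_apply, smul_eq_mul,
            Complex.conj_conj] }
    let L : H →L[ℂ] ℂ := l.mkContinuous (‖R‖ * ‖y‖) fun v => by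
      change ‖starRingEnd ℂ (σ (inner ℂ (τ' v) y))‖ ≤ _
      rw [RCLike.norm_conj, hnorm]
      calc _ ≤ ‖τ' v‖ * ‖y‖ := norm_inner_le_norm _ _
        _ ≤ ‖R‖ * ‖v‖ * ‖y‖ := by gcongr; exact hR v
        _ = _ := by ring
    refine ⟨(InnerProductSpace.toDual ℂ H).symm L, fun v => ?_⟩
    rw [← inner_conj_symm, InnerProductSpace.toDual_symm_apply]
    exact Complex.conj_conj _
  choose S hS using hex
  let S' : H →ₛₗ[σ] H :=
    { toFun := S
      map_add' := fun y z => ext_inner_left ℂ fun v => by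
        simp only [hS, inner_add_right, map_add]
      map_smul' := fun a y => ext_inner_left ℂ fun v => by
        simp only [hS, inner_smul_right, map_mul] }
  refine ⟨S'.mkContinuous ‖R‖ fun y => ?_, fun v y => hS y v⟩
  change ‖S y‖ ≤ _
  by_cases h0 : ‖S y‖ = 0
  · rw [h0]; positivity
  · have hpos : 0 < ‖S y‖ := lt_of_le_of_ne (norm_nonneg _) (Ne.symm h0)
    refine le_of_mul_le_mul_left ?_ hpos
    calc ‖S y‖ * ‖S y‖ = ‖inner ℂ (S y) (S y)‖ := by
          rw [inner_self_eq_norm_sq_to_K]; simp [sq]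
      _ = ‖inner ℂ (τ' (S y)) y‖ := by rw [hS, hnorm]
      _ ≤ ‖τ' (S y)‖ * ‖y‖ := norm_inner_le_norm _ _
      _ ≤ ‖R‖ * ‖S y‖ * ‖y‖ := by gcongr; exact hR _
      _ = _ := by ring

/-- A multiplicative map with a model on rank-one operators whose scalar map is an isometric
involution is implemented by a pair of semilinear maps. -/
lemma exists_implementation [TopologicalSpace.SeparableSpace H] {σ : ℂ →+* ℂ} [RingHomInvPair σ σ]
    (m : IsRankOneModel φ σ τ τ') (hmul : ∀ A B, φ (A * B) = φ A * φ B)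
    (hr : ∀ A : H →L[ℂ] H, FiniteDimensional ℂ (LinearMap.range (A : H →ₗ[ℂ] H)) →
      FiniteDimensional ℂ (LinearMap.range (φ A : H →ₗ[ℂ] H)) ∧
      Module.finrank ℂ (LinearMap.range (φ A : H →ₗ[ℂ] H)) =
        Module.finrank ℂ (LinearMap.range (A : H →ₗ[ℂ] H)))
    (hnorm : ∀ a, ‖σ a‖ = ‖a‖) :
    ∃ T S : H →SL[σ] H, (∀ x, S (T x) = x) ∧ ∀ A x, φ A x = T (A (S x)) := by
  have hσσ : ∀ a, σ (σ a) = a := fun _ => RingHomInvPair.comp_apply_eq (σ := σ) (σ' := σ)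
  have hrW : ∀ (W : Submodule ℂ H) [FiniteDimensional ℂ W],
      FiniteDimensional ℂ (LinearMap.range (φ W.starProjection : H →ₗ[ℂ] H)) ∧
      Module.finrank ℂ (LinearMap.range (φ W.starProjection : H →ₗ[ℂ] H)) =
        Module.finrank ℂ W := by
    intro W _
    have h1 := hr W.starProjection
    rw [W.range_starProjection] at h1
    exact h1 inferInstance
  have hσ := map_add σ
  let T : H →SL[σ] H :=
    { toFun := τ
      map_add' := m.left_add hσ hrW
      map_smul' := m.left_smul
      cont := m.continuous_left }
  have hT : ∀ x, T x = τ x := fun _ => rfl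
  obtain ⟨S, hS⟩ := m.exists_right_adjoint hnorm (m.right_add hσ hrW)
  have hST : ∀ x, S (T x) = x := fun x => ext_inner_left ℂ fun v => by
    rw [hS, hT, m.inner_left, hσσ]
  have hφS : ∀ A y, S (φ A y) = A (S y) := fun A y => ext_inner_left ℂ fun v => by
    rw [hS, m.inner_apply, ← hS, ContinuousLinearMap.adjoint_inner_left]
  have hφT : ∀ A x, φ A (T x) = T (A x) := m.apply_left
  refine ⟨T, S, hST, fun A x => ?_⟩
  let E : H →L[ℂ] H := T.comp S
  have hE : ∀ x, E x = T (S x) := fun _ => rfl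
  have hEφ : ∀ A x, E (φ A x) = φ A (E x) := fun A x => by rw [hE, hE, hφS, hφT]
  have hEE : ∀ x, E (E x) = E x := fun x => by rw [hE, hE, hST]
  have hzero : φ A * (1 - E) = 0 := by
    refine eq_zero_of_mul_of_finite_rank_eq_zero (fun A => φ A * (1 - E)) (fun A B => ?_)
      (fun A hA => ?_) A
    · ext x
      simp [hmul, hEφ, hEE]
    · let W := LinearMap.range (A : H →ₗ[ℂ] H)
      have hQA : W.starProjection * A = A := by
        ext x
        exact Submodule.starProjection_eq_self_iff.mpr ⟨x, rfl⟩
      have hτE : ∀ v x, inner ℂ (τ' v) (x - E x) = (0 : ℂ) := fun v x => by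
        rw [inner_sub_right, hE, hT, m.inner_left, hS, hσσ, sub_self]
      ext x
      change φ A (x - E x) = 0
      rw [← hQA, hmul]
      change φ W.starProjection (φ A (x - E x)) = 0
      rw [map_sub, ← hEφ,
        m.apply_starProjection W (hrW W) (stdOrthonormalBasis ℂ W)]
      simp [hτE]
  have h1 : φ A (x - E x) = 0 := congrArg (fun B : H →L[ℂ] H => B x) hzero
  rw [map_sub, sub_eq_zero] at h1
  rw [h1, hE, hφT]

end IsRankOneModel

/-- A continuous multiplicative map `φ : B(H) → B(H)` on a separable complex
Hilbert space of dimension `≥ 3` which preserves the rank of finite-rank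
operators is of the form `φ(A) = T A S` where `T, S` are either both bounded
linear or both bounded conjugate-linear maps with `S T = I`. -/
theorem stmt9 {H : Type*} [NormedAddCommGroup H] [InnerProductSpace ℂ H]
    [CompleteSpace H] [TopologicalSpace.SeparableSpace H]
    (hdim : 3 ≤ Module.rank ℂ H)
    (φ : (H →L[ℂ] H) → (H →L[ℂ] H)) (hcont : Continuous φ)
    (hmul : ∀ A B : H →L[ℂ] H, φ (A * B) = φ A * φ B)
    (hrank : ∀ A : H →L[ℂ] H,
      Module.rank ℂ (LinearMap.range (A : H →ₗ[ℂ] H)) < Cardinal.aleph0 →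
      Module.rank ℂ (LinearMap.range ((φ A) : H →ₗ[ℂ] H)) =
        Module.rank ℂ (LinearMap.range (A : H →ₗ[ℂ] H))) :
    (∃ T S : H →L[ℂ] H, (∀ x, S (T x) = x) ∧ ∀ A x, φ A x = T (A (S x))) ∨
    (∃ T S : H →L⋆[ℂ] H, (∀ x, S (T x) = x) ∧ ∀ A x, φ A x = T (A (S x))) := by
  have : Nontrivial H :=
    rank_pos_iff_nontrivial.mp (lt_of_lt_of_le (by norm_num) hdim)
  have hr : ∀ A : H →L[ℂ] H, FiniteDimensional ℂ (LinearMap.range (A : H →ₗ[ℂ] H)) →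
      FiniteDimensional ℂ (LinearMap.range (φ A : H →ₗ[ℂ] H)) ∧
      Module.finrank ℂ (LinearMap.range (φ A : H →ₗ[ℂ] H)) =
        Module.finrank ℂ (LinearMap.range (A : H →ₗ[ℂ] H)) := by
    intro A hA
    have hlt := Module.rank_lt_aleph0_iff.mpr hA
    have heq := hrank A hlt
    exact ⟨Module.rank_lt_aleph0_iff.mp (heq ▸ hlt), congrArg Cardinal.toNat heq⟩
  have hzero : φ 0 = 0 := by
    have h0 := hrank 0
    have hbot : LinearMap.range ((0 : H →L[ℂ] H) : H →ₗ[ℂ] H) = ⊥ := LinearMap.range_zero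
    rw [hbot, rank_bot] at h0
    have h1 := Submodule.rank_eq_zero.mp (h0 Cardinal.aleph0_pos)
    exact ContinuousLinearMap.ext fun x => LinearMap.congr_fun (LinearMap.range_eq_bot.mp h1) x
  have hone : ∀ x v : H, x ≠ 0 → v ≠ 0 → Module.finrank ℂ
      (LinearMap.range (φ (InnerProductSpace.rankOne ℂ x v) : H →ₗ[ℂ] H)) = 1 := by
    intro x v hx hv
    have h1 : Module.rank ℂ
        (LinearMap.range (InnerProductSpace.rankOne ℂ x v : H →ₗ[ℂ] H)) = 1 :=
      InnerProductSpace.rank_rankOne hx hv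
    have h2 := hrank _ (h1.trans_lt Cardinal.one_lt_aleph0)
    exact Module.rank_eq_one_iff_finrank_eq_one.mp (h2.trans h1)
  obtain ⟨h, τ, τ', m⟩ := exists_isRankOneModel hcont hmul hzero hone
  obtain ⟨f, hf⟩ := (Module.le_rank_iff_exists_linearMap).mp
    (show ((2 : ℕ) : Cardinal) ≤ Module.rank ℂ H from le_trans (by norm_num) hdim)
  let W : Submodule ℂ H := LinearMap.range f
  have hW : Module.finrank ℂ W = 2 := by simp [W, LinearMap.finrank_range_of_inj hf]
  have hrW := hr W.starProjection
  rw [W.range_starProjection] at hrW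
  let σ : ℂ →+* ℂ :=
    { toFun := h
      map_one' := m.scalar_one
      map_zero' := m.scalar_zero
      map_mul' := m.scalar_mul
      map_add' := m.scalar_add W (hrW inferInstance) hW }
  have hσ : IsRankOneModel φ σ τ τ' := m
  rcases Complex.ringHom_eq_id_or_conj_of_continuous (f := σ) m.continuous_scalar with h1 | h1
  · rw [h1] at hσ
    exact Or.inl (hσ.exists_implementation hmul hr fun _ => rfl)
  · rw [h1] at hσ
    exact Or.inr (hσ.exists_implementation hmul hr fun a => RCLike.norm_conj a)
end

section
/- Let H be a separable complex Hilbert space of dimension at least 3, and let φ : B(H) → B(H) be a continuous multiplicative map with φ(A*) = φ(A)* for all A, such that σ(φ(A)) ⊆ σ(A) for every A ∈ B(H). Then φ is a linear *-endomorphism of B(H): there exist linear isometries Uₙ : H → H with pairwise orthogonal ranges whose ranges span H, such that φ(A) = ∑ₙ Uₙ A Uₙ* for all A ∈ B(H). -/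
open ContinuousLinearMap

section CStarAlgebra

variable {A : Type*} [CStarAlgebra A] {φ : A → A}

theorem map_algebraMap_of_spectrum_subset
    (hmul : ∀ a b, φ (a * b) = φ a * φ b) (hstar : ∀ a, φ (star a) = star (φ a))
    (hspec : ∀ a, spectrum ℂ (φ a) ⊆ spectrum ℂ a) (c : ℂ) :
    φ (algebraMap ℂ A c) = algebraMap ℂ A c := by
  rcases subsingleton_or_nontrivial A with _ | _
  · exact Subsingleton.elim _ _
  have : IsStarNormal (φ (algebraMap ℂ A c)) := by
    refine ⟨?_⟩
    rw [Commute, SemiconjBy, ← hstar, ← hmul, ← hmul]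
    rw [← Algebra.commutes]
  refine CFC.eq_algebraMap_of_spectrum_subset_singleton _ c ?_
  exact (hspec _).trans (spectrum.scalar_eq c).subset

theorem map_smul_of_spectrum_subset
    (hmul : ∀ a b, φ (a * b) = φ a * φ b) (hstar : ∀ a, φ (star a) = star (φ a))
    (hspec : ∀ a, spectrum ℂ (φ a) ⊆ spectrum ℂ a) (c : ℂ) (a : A) :
    φ (c • a) = c • φ a := by
  rw [Algebra.smul_def, hmul, map_algebraMap_of_spectrum_subset hmul hstar hspec,
    ← Algebra.smul_def]

/-- A selfadjoint `a` with `(a - 1) (a - t) = 0` is mapped to a solution of the same equation. -/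
theorem map_sub_one_mul_map_sub_eq_zero (hstar : ∀ a, φ (star a) = star (φ a))
    (hspec : ∀ a, spectrum ℂ (φ a) ⊆ spectrum ℂ a) {a : A} (ha : IsSelfAdjoint a) (t : ℝ)
    (h : (a - 1) * (a - algebraMap ℝ A t) = 0) :
    (φ a - 1) * (φ a - algebraMap ℝ A t) = 0 := by
  rcases subsingleton_or_nontrivial A with _ | _
  · exact Subsingleton.elim _ _
  open Polynomial in
  set p : ℂ[X] := (X - C 1) * (X - C (t : ℂ)) with hp
  have hpa (x : A) : Polynomial.aeval x p = (x - 1) * (x - algebraMap ℝ A t) := by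
    simp [hp, IsScalarTower.algebraMap_apply ℝ ℂ A]
  have hφ : IsSelfAdjoint (φ a) := by rw [IsSelfAdjoint, ← hstar, ha.star_eq]
  have hsa : IsSelfAdjoint ((φ a - 1) * (φ a - algebraMap ℝ A t)) := by
    have ht : IsSelfAdjoint (algebraMap ℝ A t) := IsSelfAdjoint.algebraMap A (.all t)
    refine ((hφ.sub (.one A)).commute_iff (hφ.sub ht)).1 ?_
    have hc : Commute (φ a) (algebraMap ℝ A t) := (Algebra.commutes t (φ a)).symm
    exact ((Commute.refl _).sub_right hc).sub_left (Commute.one_left _)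
  have := hsa.isStarNormal
  refine CFC.eq_zero_of_spectrum_subset_zero (R := ℂ) _ ?_
  rw [← hpa, spectrum.map_polynomial_aeval]
  rintro _ ⟨z, hz, rfl⟩
  have hz' := spectrum.subset_polynomial_aeval a p ⟨z, hspec a hz, rfl⟩
  rwa [hpa, h, spectrum.zero_eq] at hz'

/-- If `q` is a projection orthogonal to `φ p`, then `φ (p + t (1 - p))` acts on `q` as the
scalar `t`, for small `t`. -/
theorem eventually_map_add_smul_mul_eq_smul (hcont : Continuous φ)
    (hstar : ∀ a, φ (star a) = star (φ a)) (hspec : ∀ a, spectrum ℂ (φ a) ⊆ spectrum ℂ a)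
    {p q : A} (hp : IsStarProjection p) (hq : IsIdempotentElem q) (hpq : φ p * q = 0)
    (hcomm : ∀ t : ℝ, Commute (φ (p + t • (1 - p))) q) :
    ∀ᶠ t : ℝ in nhds 0, φ (p + t • (1 - p)) * q = t • q := by
  have hlim : Filter.Tendsto (fun t : ℝ => ‖φ (p + t • (1 - p)) * q‖) (nhds 0) (nhds 0) := by
    have hc : Continuous fun t : ℝ => ‖φ (p + t • (1 - p)) * q‖ := by fun_prop
    simpa [hpq] using hc.tendsto 0
  filter_upwards [hlim.eventually (gt_mem_nhds one_pos)] with t ht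
  set a := p + t • (1 - p) with ha_def
  have hsa : IsSelfAdjoint a :=
    hp.isSelfAdjoint.add ((IsSelfAdjoint.all t).smul ((IsSelfAdjoint.one A).sub hp.isSelfAdjoint))
  have hpp : p * p = p := hp.isIdempotentElem
  have heq : (a - 1) * (a - algebraMap ℝ A t) = 0 := by
    have h1 : a - 1 = (t - 1) • (1 - p) := by rw [ha_def]; module
    have h2 : a - algebraMap ℝ A t = (1 - t) • p := by
      rw [ha_def, Algebra.algebraMap_eq_smul_one]; module
    have h3 : (1 - p) * p = 0 := by rw [sub_mul, one_mul, hpp, sub_self]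
    rw [h1, h2, smul_mul_assoc, mul_smul_comm, h3, smul_zero, smul_zero]
  have key := map_sub_one_mul_map_sub_eq_zero hstar hspec hsa t heq
  set y := (φ a - algebraMap ℝ A t) * q with hy
  have hqy : q * y = y := by
    have : Commute (φ a - algebraMap ℝ A t) q := (hcomm t).sub_left (Algebra.commutes t q)
    rw [hy, this.eq, ← mul_assoc, hq.eq]
  have hay : φ a * q * y = y := by
    rw [mul_assoc, hqy]
    have : (φ a - 1) * y = 0 := by rw [hy, ← mul_assoc, key, zero_mul]
    rwa [sub_mul, one_mul, sub_eq_zero] at this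
  have hy0 : y = 0 := by
    by_contra hne
    have h1 : ‖y‖ ≤ ‖φ a * q‖ * ‖y‖ := by
      conv_lhs => rw [← hay]
      exact norm_mul_le _ _
    have h2 : 0 < ‖y‖ := norm_pos_iff.2 hne
    nlinarith
  rw [hy, sub_mul, sub_eq_zero] at hy0
  rw [hy0, Algebra.smul_def]

theorem map_add_map_one_sub_eq_one (hcont : Continuous φ)
    (hmul : ∀ a b, φ (a * b) = φ a * φ b)
    (hstar : ∀ a, φ (star a) = star (φ a)) (hspec : ∀ a, spectrum ℂ (φ a) ⊆ spectrum ℂ a)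
    {p : A} (hp : IsStarProjection p) : φ p + φ (1 - p) = 1 := by
  have hpp : p * p = p := hp.isIdempotentElem
  have h0 : φ 0 = 0 := by simpa using map_algebraMap_of_spectrum_subset hmul hstar hspec 0
  have hp1 : p * (1 - p) = 0 := by rw [mul_sub, mul_one, hpp, sub_self]
  have h1p : (1 - p) * p = 0 := by rw [sub_mul, one_mul, hpp, sub_self]
  have hpp' : (1 - p) * (1 - p) = 1 - p := by rw [sub_mul, hp1, one_mul, sub_zero]
  have e1 : φ p * φ p = φ p := by rw [← hmul, hpp]
  have e2 : φ p * φ (1 - p) = 0 := by rw [← hmul, hp1, h0]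
  have e3 : φ (1 - p) * φ p = 0 := by rw [← hmul, h1p, h0]
  have e4 : φ (1 - p) * φ (1 - p) = φ (1 - p) := by rw [← hmul, hpp']
  set q := 1 - φ p - φ (1 - p) with hq_def
  have hq : IsIdempotentElem q := by
    simp only [IsIdempotentElem, hq_def, sub_mul, mul_sub, e1, e2, e3, e4, one_mul, mul_one]
    abel
  have hpq : φ p * q = 0 := by
    simp only [hq_def, mul_sub, e1, e2, mul_one]; abel
  have hpq' : φ (1 - p) * q = 0 := by
    simp only [hq_def, mul_sub, e3, e4, mul_one]; abel
  have hcomm (s t : ℝ) : Commute (φ (s • p + t • (1 - p))) q := by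
    have c1 : Commute (φ (s • p + t • (1 - p))) (φ p) := by
      rw [Commute, SemiconjBy, ← hmul, ← hmul]
      simp [add_mul, mul_add, hp1, h1p]
    have c2 : Commute (φ (s • p + t • (1 - p))) (φ (1 - p)) := by
      rw [Commute, SemiconjBy, ← hmul, ← hmul]
      simp only [add_mul, mul_add, smul_mul_assoc, mul_smul_comm, hp1, h1p]
    exact ((Commute.one_right _).sub_right c1).sub_right c2
  have ev1 := eventually_map_add_smul_mul_eq_smul hcont hstar hspec hp hq hpq
    fun t => by simpa using hcomm 1 t
  have ev2 := eventually_map_add_smul_mul_eq_smul hcont hstar hspec hp.one_sub hq hpq'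
    fun t => by simpa [add_comm] using hcomm t 1
  have ev : ∀ᶠ t : ℝ in nhdsWithin 0 (Set.Ioi 0), t • q = (t * t) • q := by
    filter_upwards [ev1.filter_mono nhdsWithin_le_nhds, ev2.filter_mono nhdsWithin_le_nhds]
      with t h1 h2
    have hprod : (p + t • (1 - p)) * (1 - p + t • (1 - (1 - p))) = (t : ℂ) • (1 : A) := by
      simp only [sub_sub_cancel, add_mul, mul_add, smul_mul_assoc, mul_smul_comm, hp1, h1p, hpp,
        hpp', smul_zero, zero_add, add_zero, Complex.coe_smul]
      module
    have h3 : φ ((t : ℂ) • (1 : A)) * q = t • q := by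
      rw [← Algebra.algebraMap_eq_smul_one, map_algebraMap_of_spectrum_subset hmul hstar hspec,
        Algebra.algebraMap_eq_smul_one, smul_mul_assoc, one_mul, Complex.coe_smul]
    rw [← h3, ← hprod, hmul, mul_assoc, h2, mul_smul_comm, h1, smul_smul]
  obtain ⟨t, ht, ht0, ht1⟩ := (ev.and (Ioo_mem_nhdsGT (one_pos (α := ℝ)))).exists
  have hq0 : q = 0 := by
    have h : (t - t * t) • q = 0 := by rw [sub_smul, ← ht, sub_self]
    refine (smul_eq_zero.1 h).resolve_left ?_
    nlinarith [mul_pos ht0 (sub_pos.2 ht1)]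
  rw [hq_def, sub_sub, sub_eq_zero] at hq0
  exact hq0.symm

theorem map_eq_map_mul_add_map_mul_one_sub (hcont : Continuous φ)
    (hmul : ∀ a b, φ (a * b) = φ a * φ b)
    (hstar : ∀ a, φ (star a) = star (φ a)) (hspec : ∀ a, spectrum ℂ (φ a) ⊆ spectrum ℂ a)
    {p : A} (hp : IsStarProjection p) (a : A) : φ a = φ (a * p) + φ (a * (1 - p)) := by
  rw [hmul, hmul, ← mul_add, map_add_map_one_sub_eq_one hcont hmul hstar hspec hp, mul_one]

end CStarAlgebra

section Hilbert

variable {H : Type*} [NormedAddCommGroup H] [InnerProductSpace ℂ H]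

theorem HilbertBasis.eq_zero_of_inner_eq_zero {ι : Type*} (b : HilbertBasis ι ℂ H) {x : H}
    (h : ∀ i, inner ℂ (b i) x = 0) : x = 0 := by
  refine b.repr.injective ?_
  ext i
  simp [b.repr_apply_apply, h]

theorem Orthonormal.countable_of_separableSpace [TopologicalSpace.SeparableSpace H] {ι : Type*}
    {v : ι → H} (hv : Orthonormal ℂ v) : Countable ι := by
  refine Pairwise.countable_of_isOpen_disjoint (s := fun i => Metric.ball (v i) (1 / 2)) ?_
    (fun i => Metric.isOpen_ball) (fun i => ⟨v i, by simp⟩)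
  intro i j hij
  refine Metric.ball_disjoint_ball ?_
  have h : ‖v i - v j‖ ^ 2 = 2 := by
    rw [@norm_sub_sq ℂ, hv.1, hv.1, hv.2 hij]
    norm_num
  rw [dist_eq_norm]
  nlinarith [norm_nonneg (v i - v j)]

/-- The linear isometry mapping the vectors of a Hilbert basis among themselves along an injective map. -/
theorem HilbertBasis.exists_linearIsometry_apply [CompleteSpace H] {ι : Type*}
    (b : HilbertBasis ι ℂ H)
    {f : ι → ι} (hf : Function.Injective f) : ∃ V : H →ₗᵢ[ℂ] H, ∀ i, V (b i) = b (f i) := by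
  classical
  refine ⟨(b.orthonormal.comp f hf).orthogonalFamily.linearIsometry.comp
    b.repr.toLinearIsometry, fun i => ?_⟩
  change (b.orthonormal.comp f hf).orthogonalFamily.linearIsometry (b.repr (b i)) = b (f i)
  rw [b.repr_self, OrthogonalFamily.linearIsometry_apply_single]
  simp

/-- The ranges of these injections form an almost disjoint family of subsets of `ℕ`. -/
theorem exists_almostDisjoint_injective : ∃ h : (ℕ → Bool) → ℕ → ℕ,
    (∀ f, Function.Injective (h f)) ∧
      ∀ f g, f ≠ g → ∃ N, ∀ n ≥ N, ∀ m, h f n ≠ h g m := by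
  have key : ∀ (f g : ℕ → Bool) (n m : ℕ),
      Encodable.encode ((List.range n).map f) = Encodable.encode ((List.range m).map g) →
      n = m ∧ ∀ i < n, f i = g i := by
    intro f g n m h
    have h' := Encodable.encode_injective h
    have hnm : n = m := by simpa using congrArg List.length h'
    subst hnm
    exact ⟨rfl, by simpa using h'⟩
  refine ⟨fun f n => Encodable.encode ((List.range n).map f), fun f n m h => (key f f n m h).1,
    fun f g hfg => ?_⟩
  obtain ⟨i, hi⟩ := Function.ne_iff.1 hfg
  exact ⟨i + 1, fun n hn m h => hi ((key f g n m h).2 i hn)⟩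

/-- A map preserving inner products is a linear isometry. -/
theorem exists_linearIsometry_of_inner_map_map {u : H → H}
    (hu : ∀ x y, inner ℂ (u x) (u y) = inner ℂ x y) : ∃ U : H →ₗᵢ[ℂ] H, ∀ x, U x = u x := by
  refine ⟨LinearMap.isometryOfInner
    { toFun := u, map_add' := fun x y => ?_, map_smul' := fun c x => ?_ } hu, fun x => rfl⟩
  · rw [← sub_eq_zero, ← inner_self_eq_zero (𝕜 := ℂ)]
    simp only [inner_sub_left, inner_sub_right, inner_add_left, inner_add_right, hu]
    ring
  · rw [← sub_eq_zero, ← inner_self_eq_zero (𝕜 := ℂ)]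
    simp only [inner_sub_left, inner_sub_right, inner_smul_left, inner_smul_right, hu,
      RingHom.id_apply]
    ring

variable [CompleteSpace H]

theorem map_apply_eq_zero_of_finite_support {φ : (H →L[ℂ] H) → (H →L[ℂ] H)}
    (hcont : Continuous φ) (hmul : ∀ A B : H →L[ℂ] H, φ (A * B) = φ A * φ B)
    (hstar : ∀ A : H →L[ℂ] H, φ (star A) = star (φ A))
    (hspec : ∀ A : H →L[ℂ] H, spectrum ℂ (φ A) ⊆ spectrum ℂ A) {k : H}
    (hk : ∀ x y : H, φ (InnerProductSpace.rankOne ℂ x y) k = 0) {ι : Type*}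
    (b : HilbertBasis ι ℂ H) (s : Finset ι) (A : H →L[ℂ] H) (hA : ∀ i ∉ s, A (b i) = 0) :
    φ A k = 0 := by
  classical
  induction s using Finset.induction_on generalizing A with
  | empty =>
    have hA0 : A = 0 := by
      have : adjoint A = 0 := by
        ext x
        refine b.eq_zero_of_inner_eq_zero fun i => ?_
        rw [adjoint_inner_right, hA i (by simp), inner_zero_left]
      simpa using congrArg adjoint this
    have h0 := hk 0 0
    rw [hA0]
    simpa using h0
  | insert j s hj ih =>
    have hp : IsStarProjection (InnerProductSpace.rankOne ℂ (b j) (b j)) :=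
      InnerProductSpace.isStarProjection_rankOne_self (b.orthonormal.1 j)
    rw [map_eq_map_mul_add_map_mul_one_sub hcont hmul hstar hspec hp A, add_apply,
      mul_def A, InnerProductSpace.comp_rankOne, hk, zero_add]
    refine ih _ fun i hi => ?_
    by_cases hij : i = j
    · subst hij
      simp [b.orthonormal.1]
    · have : inner ℂ (b j) (b i) = 0 := b.orthonormal.2 (Ne.symm hij)
      simp [this, hA i (by simp [hij, hi])]

/-- A vector killed by the image of every rank one operator is zero: otherwise isometries with
almost disjoint ranges would give an uncountable orthonormal family. -/
theorem eq_zero_of_map_rankOne_apply_eq_zero [TopologicalSpace.SeparableSpace H]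
    {φ : (H →L[ℂ] H) → (H →L[ℂ] H)}
    (hcont : Continuous φ) (hmul : ∀ A B : H →L[ℂ] H, φ (A * B) = φ A * φ B)
    (hstar : ∀ A : H →L[ℂ] H, φ (star A) = star (φ A))
    (hspec : ∀ A : H →L[ℂ] H, spectrum ℂ (φ A) ⊆ spectrum ℂ A) {k : H}
    (hk : ∀ x y : H, φ (InnerProductSpace.rankOne ℂ x y) k = 0) : k = 0 := by
  classical
  have hone : φ 1 = 1 := by simpa using map_algebraMap_of_spectrum_subset hmul hstar hspec 1
  obtain ⟨w, b, -⟩ := exists_hilbertBasis ℂ H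
  have : Countable w := b.orthonormal.countable_of_separableSpace
  rcases finite_or_infinite w with hw | hw
  · have := Fintype.ofFinite w
    simpa [hone] using map_apply_eq_zero_of_finite_support hcont hmul hstar hspec hk b
      Finset.univ 1 (by simp)
  by_contra hne
  obtain ⟨e⟩ : Nonempty (w ≃ ℕ) := nonempty_equiv_of_countable
  obtain ⟨h, hinj, hdisj⟩ := exists_almostDisjoint_injective
  choose V hV using fun f => b.exists_linearIsometry_apply
    (f := fun i => e.symm (h f (e i))) (e.symm.injective.comp ((hinj f).comp e.injective))
  have hVV (f g : ℕ → Bool) : inner ℂ (φ (V g).toContinuousLinearMap k)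
      (φ (V f).toContinuousLinearMap k) =
      inner ℂ k (φ (star (V g).toContinuousLinearMap * (V f).toContinuousLinearMap) k) := by
    rw [hmul, hstar, mul_apply_eq_comp, star_eq_adjoint, adjoint_inner_right]
  have hself (f : ℕ → Bool) :
      star (V f).toContinuousLinearMap * (V f).toContinuousLinearMap = 1 := by
    ext x
    refine ext_inner_left ℂ fun y => ?_
    rw [mul_apply_eq_comp, star_eq_adjoint, adjoint_inner_right]
    exact (V f).inner_map_map y x
  have horth (f g : ℕ → Bool) (hfg : f ≠ g) :
      φ (star (V g).toContinuousLinearMap * (V f).toContinuousLinearMap) k = 0 := by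
    obtain ⟨N, hN⟩ := hdisj f g hfg
    refine map_apply_eq_zero_of_finite_support hcont hmul hstar hspec hk b
      ((Finset.range N).image e.symm) _ fun i hi => ?_
    have hi' : N ≤ e i := by
      by_contra hlt
      exact hi (Finset.mem_image.2 ⟨e i, by simpa using hlt, by simp⟩)
    refine b.eq_zero_of_inner_eq_zero fun j => ?_
    rw [mul_apply_eq_comp, star_eq_adjoint, adjoint_inner_right]
    simp only [LinearIsometry.coe_toContinuousLinearMap, hV]
    exact b.orthonormal.2 fun heq => hN _ hi' (e j) (e.symm.injective heq).symm
  have hortho : Orthonormal ℂ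
      fun f => φ (V f).toContinuousLinearMap ((‖k‖⁻¹ : ℂ) • k) := by
    refine ⟨fun f => ?_, fun g f hgf => ?_⟩
    · have h1 := hVV f f
      rw [hself, hone, one_apply_eq_self, inner_self_eq_norm_sq_to_K, inner_self_eq_norm_sq_to_K] at h1
      have h2 : ‖φ (V f).toContinuousLinearMap k‖ = ‖k‖ := by
        have h3 : ‖φ (V f).toContinuousLinearMap k‖ ^ 2 = ‖k‖ ^ 2 := by exact_mod_cast h1
        exact (pow_left_inj₀ (norm_nonneg _) (norm_nonneg _) two_ne_zero).1 h3
      simp only [map_smul, norm_smul, h2]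
      simp [hne]
    · simp [hVV, horth f g hgf.symm, inner_smul_left, inner_smul_right]
  have hcount := hortho.countable_of_separableSpace
  obtain ⟨g, hg⟩ := exists_surjective_nat (ℕ → Bool)
  obtain ⟨n, hn⟩ := hg fun n => !g n n
  simpa using congrFun hn n

/-- The identity is the strong sum of the range projections of isometries with pairwise
orthogonal ranges spanning a dense subspace. -/
theorem hasSum_apply_adjoint_apply {ι : Type*} {U : ι → H →L[ℂ] H}
    (hiso : ∀ i x, ‖U i x‖ = ‖x‖) (horth : ∀ i j, i ≠ j → adjoint (U i) * U j = 0)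
    (hdense : (⨆ i, LinearMap.range (U i : H →ₗ[ℂ] H)).topologicalClosure = ⊤) (x : H) :
    HasSum (fun i => U i (adjoint (U i) x)) x := by
  let V : ι → H →ₗᵢ[ℂ] H := fun i => ⟨U i, hiso i⟩
  have hV : OrthogonalFamily ℂ (fun _ : ι => H) V := by
    intro i j hij y z
    change inner ℂ (U i y) (U j z) = 0
    rw [← adjoint_inner_right, ← mul_apply_eq_comp, horth i j hij, zero_apply, inner_zero_right]
  obtain ⟨w, rfl⟩ := (IsHilbertSum.mk hV hdense.ge).surjective_isometry x
  have hs := hV.hasSum_linearIsometry w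
  have hw (j : ι) : adjoint (U j) (hV.linearIsometry w) = w j := by
    refine (hs.mapL (adjoint (U j))).unique ?_
    have hj : adjoint (U j) (V j (w j)) = w j := by
      refine ext_inner_left ℂ fun y => ?_
      rw [adjoint_inner_right]
      exact (V j).inner_map_map y (w j)
    rw [← hj]
    refine hasSum_single j fun i hij => ?_
    change (adjoint (U j) * U i) (w i) = 0
    rw [horth j i hij.symm, zero_apply]
  convert hs using 2 with i
  rw [hw]
  rfl

end Hilbert


/-- A continuous multiplicative *-preserving map `φ : B(H) → B(H)` on a
separable complex Hilbert space of dimension `≥ 3` which is spectrum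
non-increasing is a linear *-endomorphism; more precisely, there is a countable
family of linear isometries `Uₙ : H → H` with pairwise orthogonal ranges
spanning `H` such that `φ(A) = ∑ₙ Uₙ A Uₙ*` (sum in the strong operator
topology). -/
theorem stmt11 {H : Type*} [NormedAddCommGroup H] [InnerProductSpace ℂ H]
    [CompleteSpace H] [TopologicalSpace.SeparableSpace H]
    (hdim : 3 ≤ Module.rank ℂ H)
    (φ : (H →L[ℂ] H) → (H →L[ℂ] H)) (hcont : Continuous φ)
    (hmul : ∀ A B : H →L[ℂ] H, φ (A * B) = φ A * φ B)
    (hstar : ∀ A : H →L[ℂ] H, φ (star A) = star (φ A))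
    (hspec : ∀ A : H →L[ℂ] H, spectrum ℂ (φ A) ⊆ spectrum ℂ A) :
    (∀ A B : H →L[ℂ] H, φ (A + B) = φ A + φ B) ∧
    (∀ (c : ℂ) (A : H →L[ℂ] H), φ (c • A) = c • φ A) ∧
    ∃ (ι : Type) (_ : Countable ι) (U : ι → (H →L[ℂ] H)),
      (∀ i, ∀ x : H, ‖U i x‖ = ‖x‖) ∧
      (∀ i j, i ≠ j → (adjoint (U i)) * U j = 0) ∧
      (⨆ i, LinearMap.range ((U i) : H →ₗ[ℂ] H)).topologicalClosure = ⊤ ∧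
      (∀ (A : H →L[ℂ] H) (x : H),
        HasSum (fun i => U i (A (adjoint (U i) x))) (φ A x)) := by
  have hsmul (c : ℂ) (A : H →L[ℂ] H) : φ (c • A) = c • φ A :=
    map_smul_of_spectrum_subset hmul hstar hspec c A
  have : Nontrivial H := by
    rw [← rank_pos_iff_nontrivial (R := ℂ)]
    exact lt_of_lt_of_le (by norm_num) hdim
  obtain ⟨e, he⟩ := exists_norm_eq H zero_le_one
  let T (x : H) : H →L[ℂ] H := InnerProductSpace.rankOne ℂ x e
  have hT (A : H →L[ℂ] H) (x : H) : A * T x = T (A x) := InnerProductSpace.comp_rankOne x e A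
  have hTT (x y : H) : star (T x) * T y = inner ℂ x y • T e := by
    rw [star_eq_adjoint, InnerProductSpace.adjoint_rankOne, hT]
    simp [T]
  let K : Submodule ℂ H := LinearMap.ker ((1 - φ (T e) : H →L[ℂ] H) : H →ₗ[ℂ] H)
  have hK (k : K) : φ (T e) k = k := by
    have h : (k : H) - φ (T e) k = 0 := LinearMap.mem_ker.1 k.2
    exact (sub_eq_zero.1 h).symm
  have hKc : IsClosed (K : Set H) := (1 - φ (T e) : H →L[ℂ] H).isClosed_ker
  have : CompleteSpace K := hKc.completeSpace_coe
  obtain ⟨w, b, -⟩ := exists_hilbertBasis ℂ K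
  have : Countable w := b.orthonormal.countable_of_separableSpace
  obtain ⟨f, hf⟩ := Countable.exists_injective_nat w
  let r : Set.range f ≃ w := (Equiv.ofInjective f hf).symm
  have hinner (k l : K) (x y : H) :
      inner ℂ (φ (T x) k) (φ (T y) l) = inner ℂ x y * inner ℂ k l := by
    rw [← adjoint_inner_right, ← star_eq_adjoint, ← hstar, ← mul_apply_eq_comp, ← hmul, hTT, hsmul,
      smul_apply, hK, inner_smul_right, Submodule.coe_inner]
  choose U hU using fun i : Set.range f =>
    exists_linearIsometry_of_inner_map_map (u := fun x => φ (T x) (b (r i)))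
      (fun x y => by simp [hinner, b.orthonormal.1])
  have hiso (i : Set.range f) (x : H) : ‖(U i).toContinuousLinearMap x‖ = ‖x‖ :=
    (U i).norm_map x
  have horth (i j : Set.range f) (hij : i ≠ j) :
      adjoint (U i).toContinuousLinearMap * (U j).toContinuousLinearMap = 0 := by
    ext x
    refine ext_inner_left ℂ fun y => ?_
    rw [mul_apply_eq_comp, adjoint_inner_right]
    simp only [LinearIsometry.coe_toContinuousLinearMap, hU, hinner]
    rw [b.orthonormal.2 (r.injective.ne hij)]
    simp
  have hdense : (⨆ i, LinearMap.range
      ((U i).toContinuousLinearMap : H →ₗ[ℂ] H)).topologicalClosure = ⊤ := by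
    rw [Submodule.topologicalClosure_eq_top_iff, Submodule.eq_bot_iff]
    intro k hk
    have hUk (i : Set.range f) (x : H) : inner ℂ (φ (T x) (b (r i))) k = 0 := by
      rw [← hU]
      exact (Submodule.mem_orthogonal _ _).1 hk _ (Submodule.mem_iSup_of_mem i ⟨x, rfl⟩)
    have hTk (x : H) : φ (star (T x)) k = 0 := by
      have hmem : φ (star (T x)) k ∈ K := by
        have h1 : T e * star (T x) = star (T x) := by
          have h2 : star (T e) = T e := by
            rw [star_eq_adjoint, InnerProductSpace.adjoint_rankOne]
          have h3 : T x * T e = T x := by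
            rw [hT]
            simp [T, he]
          rw [← h2, ← star_mul, h3]
        change φ (star (T x)) k - φ (T e) (φ (star (T x)) k) = 0
        rw [← mul_apply_eq_comp, ← hmul, h1, sub_self]
      have hz : (⟨φ (star (T x)) k, hmem⟩ : K) = 0 := by
        refine b.eq_zero_of_inner_eq_zero fun j => ?_
        change inner ℂ (b j : H) (φ (star (T x)) k) = 0
        rw [hstar, star_eq_adjoint, adjoint_inner_right]
        simpa using hUk (r.symm j) x
      exact congrArg Subtype.val hz
    refine eq_zero_of_map_rankOne_apply_eq_zero hcont hmul hstar hspec fun x y => ?_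
    have hxy : InnerProductSpace.rankOne ℂ x y = T x * star (T y) := by
      rw [star_eq_adjoint, InnerProductSpace.adjoint_rankOne, mul_def, InnerProductSpace.comp_rankOne]
      simp [T, he]
    rw [hxy, hmul, mul_apply_eq_comp, hTk, map_zero]
  have hsum (A : H →L[ℂ] H) (x : H) : HasSum (fun i => (U i).toContinuousLinearMap
      (A (adjoint (U i).toContinuousLinearMap x))) (φ A x) := by
    have h := (hasSum_apply_adjoint_apply hiso horth hdense x).mapL (φ A)
    convert h using 2 with i
    simp only [LinearIsometry.coe_toContinuousLinearMap, hU]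
    rw [← hT, hmul, mul_apply_eq_comp]
  refine ⟨fun A B => ?_, hsmul, Set.range f, inferInstance, fun i => (U i).toContinuousLinearMap,
    hiso, horth, hdense, hsum⟩
  ext x
  refine (hsum (A + B) x).unique ?_
  simpa using (hsum A x).add (hsum B x)
end
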